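/- arXiv:2210.17123 — 4 statements merged into one kernel-verified Lean document; each statement's English description precedes it below -/
import Mathlib

section
/- Let 𝓗 be a complex Hilbert space, A a bounded self-adjoint operator on 𝓗 with ‖A‖ < 1, and φ ∈ 𝓗. Then the operator S = 1 + A − |φ⟩⟨φ| is positive (i.e., ⟨x, S x⟩ ≥ 0 for all x ∈ 𝓗) if and only if Re⟨φ, (1 + A)⁻¹ φ⟩ ≤ 1. -/
open scoped InnerProductSpace

section

variable {𝓗 : Type*} [NormedAddCommGroup 𝓗] [InnerProductSpace ℂ 𝓗]

lemma re_inner_sub_inner_smul (x y φ : 𝓗) :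
    (⟪x, y - ⟪φ, x⟫_ℂ • φ⟫_ℂ).re = (⟪x, y⟫_ℂ).re - Complex.normSq ⟪φ, x⟫_ℂ := by
  rw [inner_sub_right, inner_smul_right, ← inner_conj_symm x φ, Complex.mul_conj,
    Complex.sub_re, Complex.ofReal_re]

/-- Subtracting the rank-one operator of `T ψ` from a nonnegative symmetric operator `T`
preserves nonnegativity if and only if `Re ⟪T ψ, ψ⟫ ≤ 1`. -/
lemma forall_re_inner_sub_rankOne_nonneg_iff {T : 𝓗 →ₗ[ℂ] 𝓗} (hT : T.IsSymmetric)
    (hpos : ∀ x, 0 ≤ (⟪x, T x⟫_ℂ).re) (ψ : 𝓗) :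
    (∀ x, 0 ≤ (⟪x, T x - ⟪T ψ, x⟫_ℂ • T ψ⟫_ℂ).re) ↔ (⟪T ψ, ψ⟫_ℂ).re ≤ 1 := by
  simp only [re_inner_sub_inner_smul]
  constructor
  · intro h
    have hψ := h ψ
    rw [← hT ψ ψ, Complex.normSq_apply] at hψ
    nlinarith [mul_self_nonneg (⟪T ψ, ψ⟫_ℂ).im]
  · intro h x
    set c := ⟪T ψ, x⟫_ℂ with hc
    have hcx : ⟪x, T ψ⟫_ℂ = starRingEnd ℂ c := (inner_conj_symm x (T ψ)).symm
    have key : ⟪x - c • ψ, T (x - c • ψ)⟫_ℂ =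
        ⟪x, T x⟫_ℂ - (Complex.normSq c : ℂ) * (2 - ⟪T ψ, ψ⟫_ℂ) := by
      simp only [map_sub, map_smul, inner_sub_left, inner_sub_right, inner_smul_left,
        inner_smul_right, ← hT ψ, ← hc, hcx, ← Complex.mul_conj]
      ring
    have hy := hpos (x - c • ψ)
    rw [key, Complex.sub_re, Complex.re_ofReal_mul, Complex.sub_re, Complex.re_ofNat] at hy
    nlinarith [Complex.normSq_nonneg c]

lemma re_inner_one_add_apply_nonneg {A : 𝓗 →L[ℂ] 𝓗} (hA : ‖A‖ ≤ 1) (x : 𝓗) :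
    0 ≤ (⟪x, (1 + A) x⟫_ℂ).re := by
  have hbound : ‖⟪x, A x⟫_ℂ‖ ≤ ‖x‖ * ‖x‖ :=
    (norm_inner_le_norm x (A x)).trans <| by
      gcongr
      exact (A.le_of_opNorm_le hA x).trans_eq (one_mul _)
  have hre := (abs_le.mp (Complex.abs_re_le_norm ⟪x, A x⟫_ℂ)).1
  have hx : (⟪x, x⟫_ℂ).re = ‖x‖ * ‖x‖ := inner_self_eq_norm_mul_norm (𝕜 := ℂ) x
  rw [add_apply, one_apply_eq_self, inner_add_right, Complex.add_re, hx]
  linarith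

end

/-- Let `𝓗` be a complex Hilbert space, `A` a bounded self-adjoint operator
on `𝓗` with `‖A‖ < 1`, and `φ ∈ 𝓗`. Then the operator `S = 1 + A − |φ⟩⟨φ|`
(acting as `S x = x + A x − ⟨φ, x⟩ φ`) is positive, i.e. `⟨x, S x⟩ ≥ 0` for all `x`,
if and only if `Re ⟨φ, (1 + A)⁻¹ φ⟩ ≤ 1`. -/
theorem absence_stmt0
    {𝓗 : Type*} [NormedAddCommGroup 𝓗] [InnerProductSpace ℂ 𝓗] [CompleteSpace 𝓗]
    (A : 𝓗 →L[ℂ] 𝓗) (hA : IsSelfAdjoint A) (hAnorm : ‖A‖ < 1) (φ : 𝓗) :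
    (∀ x : 𝓗, 0 ≤ (⟪x, x + A x - ⟪φ, x⟫_ℂ • φ⟫_ℂ).re) ↔
      (⟪φ, Ring.inverse (1 + A) φ⟫_ℂ).re ≤ 1 := by
  have hunit : IsUnit (1 + A) := by
    simpa using isUnit_one_sub_of_norm_lt_one (x := -A) (by simpa using hAnorm)
  have hinv : (1 + A) (Ring.inverse (1 + A) φ) = φ :=
    DFunLike.congr_fun (Ring.mul_inverse_cancel (1 + A) hunit) φ
  have hsymm : ((1 + A : 𝓗 →L[ℂ] 𝓗) : 𝓗 →ₗ[ℂ] 𝓗).IsSymmetric :=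
    ((IsSelfAdjoint.one _).add hA).isSymmetric
  have h := forall_re_inner_sub_rankOne_nonneg_iff hsymm
    (re_inner_one_add_apply_nonneg hAnorm.le) (Ring.inverse (1 + A) φ)
  simp only [ContinuousLinearMap.coe_coe, hinv] at h
  exact h
end

section
/- Let 𝓗 be a complex Hilbert space, A a bounded self-adjoint operator on 𝓗 with ‖A‖ < 1, and φ ∈ 𝓗 with φ ≠ 0. If Re⟨φ, (1 + A)⁻¹ φ⟩ = 1, then the operator S = 1 + A − |φ⟩⟨φ| satisfies: (i) ⟨x, S x⟩ ≥ 0 for all x ∈ 𝓗; (ii) the vector ψ := (1 + A)⁻¹ φ is nonzero and S ψ = 0; and consequently (iii) the infimum of the real spectrum of S equals 0. -/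
open scoped InnerProductSpace

section RankOnePerturbation

variable {E : Type*} [NormedAddCommGroup E] [InnerProductSpace ℂ E]

/-- If `‖A‖ ≤ 1` and `A` is symmetric, then `1 + A` is a positive operator. -/
lemma ContinuousLinearMap.isPositive_one_add_of_norm_le_one {A : E →L[ℂ] E}
    (hA : A.toLinearMap.IsSymmetric) (hAnorm : ‖A‖ ≤ 1) : (1 + A).IsPositive := by
  refine ⟨LinearMap.IsSymmetric.add (fun _ _ => rfl) hA, fun x => ?_⟩
  have hbound : |(⟪A x, x⟫_ℂ).re| ≤ ‖x‖ * ‖x‖ :=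
    (Complex.abs_re_le_norm _).trans <| (norm_inner_le_norm _ _).trans <|
      mul_le_mul_of_nonneg_right (A.le_of_opNorm_le_of_le hAnorm le_rfl |>.trans_eq (one_mul _))
        (norm_nonneg x)
  have hself : (⟪x, x⟫_ℂ).re = ‖x‖ * ‖x‖ := inner_self_eq_norm_mul_norm (𝕜 := ℂ) x
  simp only [reApplyInnerSelf_apply, add_apply, one_apply_eq_self, inner_add_left, RCLike.re_to_complex,
    Complex.add_re, hself]
  linarith [neg_abs_le (⟪A x, x⟫_ℂ).re]

/-- If `T` is positive, then so is `T - |T ψ⟩⟨T ψ|` as soon as `⟨T ψ, ψ⟩ = 1`. -/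
lemma ContinuousLinearMap.IsPositive.sub_smulRight {T : E →L[ℂ] E} (hT : T.IsPositive) {ψ : E}
    (hψ : ⟪T ψ, ψ⟫_ℂ = 1) : (T - (innerSL ℂ (T ψ)).smulRight (T ψ)).IsPositive := by
  refine ⟨LinearMap.IsSymmetric.sub hT.isSymmetric fun x y => ?_, fun x => ?_⟩
  · simp [inner_smul_left, inner_smul_right, mul_comm]
  · set y := x - ⟪T ψ, x⟫_ℂ • ψ with hy
    have horth : ⟪T ψ, y⟫_ℂ = 0 := by simp [hy, hψ]
    have hSx : (T - (innerSL ℂ (T ψ)).smulRight (T ψ)) x = T y := by simp [hy]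
    have hx : x = y + ⟪T ψ, x⟫_ℂ • ψ := by simp [hy]
    have hTy : ⟪T y, ψ⟫_ℂ = 0 := by
      rw [hT.isSymmetric.apply_clm y ψ, ← inner_conj_symm, horth, map_zero]
    have hquad : ⟪T y, x⟫_ℂ = ⟪T y, y⟫_ℂ := by
      rw [hx, inner_add_right, inner_smul_right, hTy, mul_zero, add_zero]
    rw [reApplyInnerSelf_apply, hSx, hquad]
    exact hT.re_inner_nonneg_left y

end RankOnePerturbation

/-- Let `𝓗` be a complex Hilbert space, `A` a bounded self-adjoint operator
on `𝓗` with `‖A‖ < 1`, and `φ ∈ 𝓗` nonzero. If `Re ⟨φ, (1 + A)⁻¹ φ⟩ = 1`, then the operator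
`S = 1 + A − |φ⟩⟨φ|` satisfies: (i) `⟨x, S x⟩ ≥ 0` for all `x`; (ii) `ψ := (1 + A)⁻¹ φ` is
nonzero and `S ψ = 0`; and consequently (iii) the infimum of the real spectrum of `S` is `0`. -/
theorem absence_stmt1
    {𝓗 : Type*} [NormedAddCommGroup 𝓗] [InnerProductSpace ℂ 𝓗] [CompleteSpace 𝓗]
    (A : 𝓗 →L[ℂ] 𝓗) (hA : IsSelfAdjoint A) (hAnorm : ‖A‖ < 1)
    (φ : 𝓗) (hφ : φ ≠ 0)
    (hone : (⟪φ, Ring.inverse (1 + A) φ⟫_ℂ).re = 1) :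
    (∀ x : 𝓗, 0 ≤ (⟪x, x + A x - ⟪φ, x⟫_ℂ • φ⟫_ℂ).re) ∧
    (Ring.inverse (1 + A) φ ≠ 0 ∧
      (1 + A - (innerSL ℂ φ).smulRight φ) (Ring.inverse (1 + A) φ) = 0) ∧
    sInf (spectrum ℝ (1 + A - (innerSL ℂ φ).smulRight φ)) = 0 := by
  have hunit : IsUnit (1 + A) := by
    simpa using isUnit_one_sub_of_norm_lt_one (x := -A) (by rwa [norm_neg])
  have hT : (1 + A).IsPositive :=
    ContinuousLinearMap.isPositive_one_add_of_norm_le_one hA.isSymmetric hAnorm.le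
  set ψ := Ring.inverse (1 + A) φ
  have hTψ : (1 + A) ψ = φ := by
    rw [← mul_apply_eq_comp, Ring.mul_inverse_cancel _ hunit, one_apply_eq_self]
  have hinner : ⟪φ, ψ⟫_ℂ = 1 := by
    refine Complex.ext hone ?_
    rw [← hTψ]
    exact hT.isSymmetric.im_inner_apply_self ψ
  have hψ : ψ ≠ 0 := by
    intro h
    simp [h] at hinner
  have hS : (1 + A - (innerSL ℂ φ).smulRight φ).IsPositive := by
    have h := hT.sub_smulRight (ψ := ψ) (by rwa [hTψ])
    rwa [hTψ] at h
  have hker : (1 + A - (innerSL ℂ φ).smulRight φ) ψ = 0 := by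
    rw [sub_apply, hTψ]
    simp [hinner]
  refine ⟨fun x => hS.re_inner_nonneg_right x, ⟨hψ, hker⟩, ?_⟩
  have hzero : (0 : ℝ) ∈ spectrum ℝ (1 + A - (innerSL ℂ φ).smulRight φ) := by
    rw [spectrum.zero_mem_iff]
    rintro ⟨u, hu⟩
    refine hψ ?_
    rw [← hu] at hker
    calc ψ = (↑u⁻¹ * ↑u : 𝓗 →L[ℂ] 𝓗) ψ := by rw [u.inv_mul, one_apply_eq_self]
      _ = 0 := by rw [mul_apply_eq_comp, hker, map_zero]
  have hleast : IsLeast (spectrum ℝ (1 + A - (innerSL ℂ φ).smulRight φ)) 0 :=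
    ⟨hzero, fun _ hr => spectrum_nonneg_of_nonneg
      ((ContinuousLinearMap.nonneg_iff_isPositive _).2 hS) hr⟩
  exact hleast.csInf_eq
end

section
/- Let 𝓗 be a complex Hilbert space, A a bounded self-adjoint operator on 𝓗 with ‖A‖ < 1, and φ ∈ 𝓗. Let (1 + A)^{1/2} denote the positive square root of the positive invertible operator 1 + A. Then the operator S = 1 + A − |φ⟩⟨φ| is positive (⟨x, S x⟩ ≥ 0 for all x) if and only if ‖((1 + A)^{1/2})⁻¹ φ‖ ≤ 1. Moreover S = (1 + A)^{1/2} (1 − |η⟩⟨η|) (1 + A)^{1/2}, where η := ((1 + A)^{1/2})⁻¹ φ. -/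
open scoped InnerProductSpace

section RankOnePerturbation

variable {H : Type*} [NormedAddCommGroup H] [InnerProductSpace ℂ H]

/-- The quadratic form of `1 - |η⟩⟨η|` at `y` is `‖y‖² - |⟨η, y⟩|²`. -/
lemma re_inner_one_sub_rankOne (η y : H) :
    (⟪y, (1 - (innerSL ℂ η).smulRight η) y⟫_ℂ).re = ‖y‖ ^ 2 - ‖⟪η, y⟫_ℂ‖ ^ 2 := by
  have hy : (⟪y, y⟫_ℂ).re = ‖y‖ ^ 2 := inner_self_eq_norm_sq (𝕜 := ℂ) y
  have hηy : ⟪η, y⟫_ℂ * ⟪y, η⟫_ℂ = ((‖⟪η, y⟫_ℂ‖ ^ 2 : ℝ) : ℂ) := by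
    rw [← inner_conj_symm y η, Complex.mul_conj, Complex.normSq_eq_norm_sq]
  simp only [sub_apply, one_apply_eq_self,
    ContinuousLinearMap.smulRight_apply, innerSL_apply_apply, inner_sub_right, inner_smul_right,
    hηy, Complex.sub_re, Complex.ofReal_re, hy]

/-- The operator `1 - |η⟩⟨η|` is positive if and only if `‖η‖ ≤ 1`. -/
lemma forall_re_inner_one_sub_rankOne_nonneg_iff (η : H) :
    (∀ y : H, 0 ≤ (⟪y, (1 - (innerSL ℂ η).smulRight η) y⟫_ℂ).re) ↔ ‖η‖ ≤ 1 := by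
  simp only [re_inner_one_sub_rankOne, sub_nonneg]
  constructor
  · intro h
    have hη := h η
    rw [inner_self_eq_norm_sq_to_K] at hη
    simp only [norm_pow, RCLike.norm_ofReal, abs_norm] at hη
    by_contra! hlt
    nlinarith [one_lt_pow₀ hlt two_ne_zero]
  · intro h y
    gcongr
    exact (norm_inner_le_norm η y).trans (mul_le_of_le_one_left (norm_nonneg y) h)

/-- An invertible operator undoes its inverse. -/
lemma IsUnit.clm_apply_inverse_apply {R : H →L[ℂ] H} (hR : IsUnit R) (y : H) :
    R (Ring.inverse R y) = y :=
  DFunLike.congr_fun (Ring.mul_inverse_cancel R hR) y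

variable [CompleteSpace H]

/-- For self-adjoint `R`, conjugating `1 - |η⟩⟨η|` by `R` gives `R² - |Rη⟩⟨Rη|`. -/
lemma IsSelfAdjoint.mul_one_sub_rankOne_mul {R : H →L[ℂ] H} (hR : IsSelfAdjoint R) (η : H) :
    R * (1 - (innerSL ℂ η).smulRight η) * R
      = R * R - (innerSL ℂ (R η)).smulRight (R η) := by
  ext x
  simp [hR.isSymmetric.apply_clm η x]

/-- Conjugation by an invertible self-adjoint operator preserves and reflects positivity. -/
lemma IsSelfAdjoint.forall_re_inner_conj_nonneg_iff {R : H →L[ℂ] H} (hR : IsSelfAdjoint R)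
    (hunit : IsUnit R) (T : H →L[ℂ] H) :
    (∀ x : H, 0 ≤ (⟪x, (R * T * R) x⟫_ℂ).re) ↔ ∀ y : H, 0 ≤ (⟪y, T y⟫_ℂ).re := by
  have hconj (x : H) : ⟪x, (R * T * R) x⟫_ℂ = ⟪R x, T (R x)⟫_ℂ :=
    (hR.isSymmetric x (T (R x))).symm
  have hsurj : Function.Surjective R := fun y =>
    ⟨Ring.inverse R y, hunit.clm_apply_inverse_apply y⟩
  simp only [hconj]
  exact (hsurj.forall (p := fun y => 0 ≤ (⟪y, T y⟫_ℂ).re)).symm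

/-- A self-adjoint operator of norm at most one is bounded below by `-1`. -/
lemma IsSelfAdjoint.one_add_nonneg_of_norm_le_one {A : H →L[ℂ] H} (hA : IsSelfAdjoint A)
    (hnorm : ‖A‖ ≤ 1) : 0 ≤ 1 + A := by
  have hle : algebraMap ℝ (H →L[ℂ] H) ‖A‖ ≤ 1 := by
    simpa using algebraMap_mono (H →L[ℂ] H) hnorm
  rw [← neg_le_iff_add_nonneg']
  exact (neg_le_neg hle).trans hA.neg_algebraMap_norm_le_self

end RankOnePerturbation

/-- Let `𝓗` be a complex Hilbert space, `A` a bounded self-adjoint operator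
on `𝓗` with `‖A‖ < 1`, and `φ ∈ 𝓗`. Let `(1 + A)^{1/2}` denote the positive square root of the
positive invertible operator `1 + A` (given by `CFC.sqrt`). Then `S = 1 + A − |φ⟩⟨φ|` is
positive (`⟨x, S x⟩ ≥ 0` for all `x`) if and only if `‖((1 + A)^{1/2})⁻¹ φ‖ ≤ 1`.
Moreover `S = (1 + A)^{1/2} (1 − |η⟩⟨η|) (1 + A)^{1/2}` with `η := ((1 + A)^{1/2})⁻¹ φ`. -/
theorem absence_stmt2
    {𝓗 : Type*} [NormedAddCommGroup 𝓗] [InnerProductSpace ℂ 𝓗] [CompleteSpace 𝓗]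
    (A : 𝓗 →L[ℂ] 𝓗) (hA : IsSelfAdjoint A) (hAnorm : ‖A‖ < 1) (φ : 𝓗) :
    ((∀ x : 𝓗, 0 ≤ (⟪x, x + A x - ⟪φ, x⟫_ℂ • φ⟫_ℂ).re) ↔
        ‖Ring.inverse (CFC.sqrt (1 + A)) φ‖ ≤ 1) ∧
    (1 + A - (innerSL ℂ φ).smulRight φ) =
      CFC.sqrt (1 + A) *
        (1 - (innerSL ℂ (Ring.inverse (CFC.sqrt (1 + A)) φ)).smulRight
              (Ring.inverse (CFC.sqrt (1 + A)) φ)) *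
        CFC.sqrt (1 + A) := by
  have hnonneg : 0 ≤ 1 + A := hA.one_add_nonneg_of_norm_le_one hAnorm.le
  have hunit : IsUnit (CFC.sqrt (1 + A)) := by
    rw [CFC.isUnit_sqrt_iff (1 + A), ← sub_neg_eq_add]
    exact isUnit_one_sub_of_norm_lt_one (by rwa [norm_neg])
  have hsa : IsSelfAdjoint (CFC.sqrt (1 + A)) := .of_nonneg (CFC.sqrt_nonneg _)
  have hφ : CFC.sqrt (1 + A) (Ring.inverse (CFC.sqrt (1 + A)) φ) = φ :=
    hunit.clm_apply_inverse_apply φ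
  have hfactor := hsa.mul_one_sub_rankOne_mul (Ring.inverse (CFC.sqrt (1 + A)) φ)
  rw [hφ, CFC.sqrt_mul_sqrt_self (1 + A)] at hfactor
  refine ⟨?_, hfactor.symm⟩
  rw [← forall_re_inner_one_sub_rankOne_nonneg_iff,
    ← hsa.forall_re_inner_conj_nonneg_iff hunit, hfactor]
  rfl
end

section
/- Let 𝓗 be a complex Hilbert space, T a bounded self-adjoint operator on 𝓗 with ⟨x, T x⟩ ≥ 0 for all x, v ∈ 𝓗, and a ∈ ℝ. Then there is at most one ε ∈ (0, ∞) satisfying the equation ε − a = Re⟨v, (T + ε·1)⁻¹ v⟩. -/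
open scoped InnerProductSpace

section PositiveResolvent

variable {𝓗 : Type*} [NormedAddCommGroup 𝓗] [InnerProductSpace ℂ 𝓗]

theorem re_inner_add_smul_one_apply (T : 𝓗 →L[ℂ] 𝓗) (ε : ℝ) (x : 𝓗) :
    (⟪x, (T + (ε : ℂ) • (1 : 𝓗 →L[ℂ] 𝓗)) x⟫_ℂ).re = (⟪x, T x⟫_ℂ).re + ε * ‖x‖ ^ 2 := by
  have h : (⟪x, x⟫_ℂ).re = ‖x‖ ^ 2 := inner_self_eq_norm_sq (𝕜 := ℂ) x
  simp [h, -inner_self_eq_norm_sq_to_K]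

theorem isUnit_add_smul_one_of_re_inner_nonneg [CompleteSpace 𝓗] {T : 𝓗 →L[ℂ] 𝓗}
    (hTpos : ∀ x : 𝓗, 0 ≤ (⟪x, T x⟫_ℂ).re) {ε : ℝ} (hε : 0 < ε) :
    IsUnit (T + (ε : ℂ) • (1 : 𝓗 →L[ℂ] 𝓗)) := by
  refine ContinuousLinearMap.isUnit_of_forall_le_norm_inner_map _ (c := ⟨ε, hε.le⟩) hε fun x => ?_
  rw [norm_inner_symm]
  refine le_trans ?_ (Complex.re_le_norm _)
  rw [re_inner_add_smul_one_apply]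
  have := hTpos x
  change ‖x‖ ^ 2 * ε ≤ _
  linarith

theorem add_smul_one_apply_inverse_apply [CompleteSpace 𝓗] {T : 𝓗 →L[ℂ] 𝓗}
    (hTpos : ∀ x : 𝓗, 0 ≤ (⟪x, T x⟫_ℂ).re) {ε : ℝ} (hε : 0 < ε) (v : 𝓗) :
    T (Ring.inverse (T + (ε : ℂ) • (1 : 𝓗 →L[ℂ] 𝓗)) v) +
      (ε : ℂ) • Ring.inverse (T + (ε : ℂ) • (1 : 𝓗 →L[ℂ] 𝓗)) v = v :=
  DFunLike.congr_fun
    (Ring.mul_inverse_cancel _ (isUnit_add_smul_one_of_re_inner_nonneg hTpos hε)) v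

/-- The diagonal matrix elements of the resolvent of a positive operator decrease in `ε`. -/
theorem re_inner_inverse_add_smul_one_antitoneOn [CompleteSpace 𝓗] {T : 𝓗 →L[ℂ] 𝓗}
    (hT : IsSelfAdjoint T) (hTpos : ∀ x : 𝓗, 0 ≤ (⟪x, T x⟫_ℂ).re) (v : 𝓗) :
    AntitoneOn (fun ε : ℝ => (⟪v, Ring.inverse (T + (ε : ℂ) • (1 : 𝓗 →L[ℂ] 𝓗)) v⟫_ℂ).re)
      (Set.Ioi 0) := by
  intro ε₁ h₁ ε₂ h₂ h
  have hx := add_smul_one_apply_inverse_apply hTpos h₁ v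
  have hy := add_smul_one_apply_inverse_apply hTpos h₂ v
  dsimp only
  generalize Ring.inverse (T + (ε₁ : ℂ) • (1 : 𝓗 →L[ℂ] 𝓗)) v = x at *
  generalize Ring.inverse (T + (ε₂ : ℂ) • (1 : 𝓗 →L[ℂ] 𝓗)) v = y at *
  have hdiff : (⟪v, x⟫_ℂ).re - (⟪v, y⟫_ℂ).re = (ε₂ - ε₁) * (⟪y, x⟫_ℂ).re := by
    have hvx : (⟪v, x⟫_ℂ).re = (⟪y, T x⟫_ℂ).re + ε₂ * (⟪y, x⟫_ℂ).re := by
      have hsymm : ⟪T y, x⟫_ℂ = ⟪y, T x⟫_ℂ := hT.isSymmetric y x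
      rw [← hy, inner_add_left, inner_smul_left, hsymm]
      simp
    have hvy : (⟪v, y⟫_ℂ).re = (⟪y, T x⟫_ℂ).re + ε₁ * (⟪y, x⟫_ℂ).re := by
      have hre : (⟪v, y⟫_ℂ).re = (⟪y, v⟫_ℂ).re := inner_re_symm (𝕜 := ℂ) v y
      rw [hre, ← hx, inner_add_right, inner_smul_right]
      simp
    rw [hvx, hvy]
    ring
  have hd : (T + (ε₁ : ℂ) • (1 : 𝓗 →L[ℂ] 𝓗)) (x - y) = ((ε₂ - ε₁ : ℝ) : ℂ) • y := by
    have hxy := hx.trans hy.symm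
    simp only [add_apply, smul_apply, one_apply_eq_self,
      map_sub, Complex.ofReal_sub, sub_smul]
    rw [hxy]
    abel
  have hpos := re_inner_add_smul_one_apply T ε₁ (x - y)
  rw [hd, inner_smul_right, Complex.re_ofReal_mul] at hpos
  have hsub : (⟪x - y, y⟫_ℂ).re = (⟪y, x⟫_ℂ).re - ‖y‖ ^ 2 := by
    have hre : (⟪x, y⟫_ℂ).re = (⟪y, x⟫_ℂ).re := inner_re_symm (𝕜 := ℂ) x y
    have hnorm : (⟪y, y⟫_ℂ).re = ‖y‖ ^ 2 := inner_self_eq_norm_sq (𝕜 := ℂ) y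
    rw [inner_sub_left, Complex.sub_re, hre, hnorm]
  have hTxy := hTpos (x - y)
  have hε₁ : 0 ≤ ε₁ * ‖x - y‖ ^ 2 := mul_nonneg (le_of_lt h₁) (sq_nonneg _)
  have hy2 : 0 ≤ (ε₂ - ε₁) * ‖y‖ ^ 2 := mul_nonneg (sub_nonneg.2 h) (sq_nonneg _)
  rw [hsub, mul_sub] at hpos
  linarith

end PositiveResolvent

/-- Let `𝓗` be a complex Hilbert space, `T` a bounded self-adjoint positive
operator on `𝓗`, `v ∈ 𝓗`, and `a ∈ ℝ`. Then there is at most one `ε ∈ (0, ∞)` satisfying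
`ε − a = Re ⟨v, (T + ε·1)⁻¹ v⟩`. -/
theorem absence_stmt5
    {𝓗 : Type*} [NormedAddCommGroup 𝓗] [InnerProductSpace ℂ 𝓗] [CompleteSpace 𝓗]
    (T : 𝓗 →L[ℂ] 𝓗) (hT : IsSelfAdjoint T)
    (hTpos : ∀ x : 𝓗, 0 ≤ (⟪x, T x⟫_ℂ).re)
    (v : 𝓗) (a : ℝ) :
    ∀ ε₁ ε₂ : ℝ, 0 < ε₁ → 0 < ε₂ →
      ε₁ - a = (⟪v, Ring.inverse (T + (ε₁ : ℂ) • (1 : 𝓗 →L[ℂ] 𝓗)) v⟫_ℂ).re →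
      ε₂ - a = (⟪v, Ring.inverse (T + (ε₂ : ℂ) • (1 : 𝓗 →L[ℂ] 𝓗)) v⟫_ℂ).re →
      ε₁ = ε₂ := by
  intro ε₁ ε₂ h₁ h₂ e₁ e₂
  have hanti := re_inner_inverse_add_smul_one_antitoneOn hT hTpos v
  rcases le_total ε₁ ε₂ with h | h
  · have := hanti h₁ h₂ h
    dsimp only at this
    linarith
  · have := hanti h₂ h₁ h
    dsimp only at this
    linarith
end
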